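/- Let n ≥ 3 and let u : ℝ^n → ℝ be harmonic (twice continuously differentiable with vanishing Laplacian) on {x ∈ ℝ^n : |x| > 1}, and suppose sup_{|x| ≥ 2} |u(x)|/|x|^m < ∞ for some m ∈ ℕ. Then there exist a real polynomial p on ℝ^n of degree at most m and a constant C such that |u(x) − p(x)| ≤ C|x|^{2−n} and |∇u(x) − ∇p(x)| ≤ C|x|^{1−n} for all |x| ≥ 2. Moreover, if u(−x₁, x₂, …, x_n) = −u(x₁, x₂, …, x_n) (resp. = u(x₁, x₂, …, x_n)) for all |x| > 1, then p can be taken odd (resp. even) with respect to x₁. -/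

import Mathlib

open MeasureTheory Metric Set Filter

noncomputable section

/-- The point `(x', t)` of `ℝ^{n+1}`, where `x' ∈ ℝ^n`. -/
def thinEmbed (n : ℕ) (x' : EuclideanSpace ℝ (Fin n)) (t : ℝ) :
    EuclideanSpace ℝ (Fin (n + 1)) :=
  (EuclideanSpace.equiv (Fin (n + 1)) ℝ).symm (Fin.snoc (fun i => x' i) t)

/-- Projection of a point of `ℝ^{n+1}` to its first `n` coordinates. -/
def thinProj (n : ℕ) (x : EuclideanSpace ℝ (Fin (n + 1))) : EuclideanSpace ℝ (Fin n) :=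
  (EuclideanSpace.equiv (Fin n) ℝ).symm (fun i => x i.castSucc)

/-- The Laplacian of `f : ℝ^d → ℝ`: the sum of pure second partial derivatives. -/
def lapl (d : ℕ) (f : EuclideanSpace ℝ (Fin d) → ℝ) (x : EuclideanSpace ℝ (Fin d)) : ℝ :=
  ∑ i : Fin d,
    fderiv ℝ (fun y => fderiv ℝ f y (EuclideanSpace.single i 1)) x (EuclideanSpace.single i 1)

/-- `f` is harmonic on a set: twice continuously differentiable with vanishing Laplacian. -/
def IsHarmonicOnSet (d : ℕ) (f : EuclideanSpace ℝ (Fin d) → ℝ)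
    (s : Set (EuclideanSpace ℝ (Fin d))) : Prop :=
  ContDiffOn ℝ 2 f s ∧ ∀ x ∈ s, lapl d f x = 0

/-- Super-mean-value property w.r.t. averages over balls
(encodes `Δf ≤ 0` for continuous `f`). -/
def SuperMeanVal (d : ℕ) (f : EuclideanSpace ℝ (Fin d) → ℝ) : Prop :=
  ∀ (x : EuclideanSpace ℝ (Fin d)) (r : ℝ), 0 < r → (⨍ y in Metric.ball x r, f y) ≤ f x

/-- The contact set `Λ_φ(u) = {(x',0) : u(x',0) = φ(x')}`. -/
def contactSet (n : ℕ) (φ : EuclideanSpace ℝ (Fin n) → ℝ)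
    (u : EuclideanSpace ℝ (Fin (n + 1)) → ℝ) : Set (EuclideanSpace ℝ (Fin (n + 1))) :=
  {x | x (Fin.last n) = 0 ∧ u x = φ (thinProj n x)}

/-- Global solution to the thin obstacle problem in `ℝ^{n+1}` with thin obstacle `φ`:
continuous, even in the last variable, above the obstacle on the thin space,
harmonic outside the contact set, and superharmonic (mean value inequality). -/
def IsGlobalSolution (n : ℕ) (φ : EuclideanSpace ℝ (Fin n) → ℝ)
    (u : EuclideanSpace ℝ (Fin (n + 1)) → ℝ) : Prop :=
  Continuous u ∧
  (∀ x' t, u (thinEmbed n x' t) = u (thinEmbed n x' (-t))) ∧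
  (∀ x', φ x' ≤ u (thinEmbed n x' 0)) ∧
  IsHarmonicOnSet (n + 1) u (contactSet n φ u)ᶜ ∧
  SuperMeanVal (n + 1) u

/-- Evaluation of a real polynomial at a point of `ℝ^d`. -/
def pev {d : ℕ} (q : MvPolynomial (Fin d) ℝ) (x : EuclideanSpace ℝ (Fin d)) : ℝ :=
  MvPolynomial.eval (fun i => x i) q

/-- Polynomial growth (of some order). -/
def HasPolyGrowth (d : ℕ) (u : EuclideanSpace ℝ (Fin d) → ℝ) : Prop :=
  ∃ (m : ℕ) (C : ℝ), ∀ x, |u x| ≤ C * (1 + ‖x‖ ^ m)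

/-- Polynomial growth of order exactly `m` (and `m` is the smallest such order). -/
def PolyGrowthOrder (d : ℕ) (u : EuclideanSpace ℝ (Fin d) → ℝ) (m : ℕ) : Prop :=
  (∃ C : ℝ, ∀ x, |u x| ≤ C * (1 + ‖x‖ ^ m)) ∧
  ∀ m' : ℕ, (∃ C : ℝ, ∀ x, |u x| ≤ C * (1 + ‖x‖ ^ m')) → m ≤ m'

/-- The class `𝒫ᵒ_{n+1}`: polynomials `q` even in the last variable such that
`x_{n+1} q(x)` is harmonic and `closure {q(·,0) < 0}` is compact. -/
def MemPo (n : ℕ) (q : MvPolynomial (Fin (n + 1)) ℝ) : Prop :=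
  (∀ x' t, pev q (thinEmbed n x' t) = pev q (thinEmbed n x' (-t))) ∧
  IsHarmonicOnSet (n + 1) (fun x => x (Fin.last n) * pev q x) Set.univ ∧
  IsCompact (closure {x' : EuclideanSpace ℝ (Fin n) | pev q (thinEmbed n x' 0) < 0})

/-- The class `𝒫ᵉ_{n+1}`: harmonic polynomials `p` even in the last variable such that
`closure {p(·,0) < 0}` is compact. -/
def MemPe (n : ℕ) (p : MvPolynomial (Fin (n + 1)) ℝ) : Prop :=
  (∀ x' t, pev p (thinEmbed n x' t) = pev p (thinEmbed n x' (-t))) ∧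
  IsHarmonicOnSet (n + 1) (pev p) Set.univ ∧
  IsCompact (closure {x' : EuclideanSpace ℝ (Fin n) | pev p (thinEmbed n x' 0) < 0})

/-- `f(x) → 0` as `|x| → ∞`. -/
def VanishAtInfty (d : ℕ) (f : EuclideanSpace ℝ (Fin d) → ℝ) : Prop :=
  ∀ ε > 0, ∃ R : ℝ, ∀ x, R ≤ ‖x‖ → |f x| < ε

/-- The embedding of a subset of `ℝ^n` into the thin space of `ℝ^{n+1}`. -/
def thinSet (n : ℕ) (S : Set (EuclideanSpace ℝ (Fin n))) :
    Set (EuclideanSpace ℝ (Fin (n + 1))) :=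
  (fun x' => thinEmbed n x' 0) '' S

/-- The free boundary `Γ(u)`: the boundary in `ℝ^n` of the positivity set, embedded. -/
def freeBoundary (n : ℕ) (u : EuclideanSpace ℝ (Fin (n + 1)) → ℝ) :
    Set (EuclideanSpace ℝ (Fin (n + 1))) :=
  thinSet n (frontier {x' : EuclideanSpace ℝ (Fin n) | 0 < u (thinEmbed n x' 0)})

/-- Negating the `i`-th coordinate of a point of `ℝ^d`. -/
def negCoordAt (d : ℕ) (i : Fin d) (x : EuclideanSpace ℝ (Fin d)) :
    EuclideanSpace ℝ (Fin d) :=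
  (EuclideanSpace.equiv (Fin d) ℝ).symm (Function.update (fun j => x j) i (-(x i)))

/-- The constant `ρ̄(k, n)`, where `κ = k/(n-1)`. -/
def rhoBar (k n : ℕ) : ℝ :=
  ((k : ℝ) / ((n : ℝ) - 1)) ^ (-(1 : ℝ) / (((n : ℝ) - 1) * ((k : ℝ) / ((n : ℝ) - 1) + 1))) *
    (((k : ℝ) / ((n : ℝ) - 1)) ^
        (-((k : ℝ) / ((n : ℝ) - 1)) / ((k : ℝ) / ((n : ℝ) - 1) + 1)) +
      ((k : ℝ) / ((n : ℝ) - 1)) ^ ((1 : ℝ) / ((k : ℝ) / ((n : ℝ) - 1) + 1))) ^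
      (-(1 : ℝ) / (((n : ℝ) - 1) * ((k : ℝ) / ((n : ℝ) - 1))))

/-- The barrier function `g_{A,t}(r) = A r^{1-n} + t - 1 + r^k`. -/
def gfun (n k : ℕ) (A t r : ℝ) : ℝ :=
  A * r ^ ((1 : ℝ) - (n : ℝ)) + t - 1 + r ^ k

section ParametricIntegral

variable {E P F : Type*} [NormedAddCommGroup E] [MeasurableSpace E] [BorelSpace E]
  {μ : Measure E} [IsFiniteMeasureOnCompacts μ]
  [NormedAddCommGroup P] [NormedSpace ℝ P] [FiniteDimensional ℝ P]
  [NormedAddCommGroup F] [NormedSpace ℝ F]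

theorem hasFDerivAt_integral_smul_of_hasCompactSupport {f : E → ℝ} (hf : Continuous f)
    (hfc : HasCompactSupport f) {G : P → E → F} {G' : P → E → P →L[ℝ] F}
    (hG : Continuous (Function.uncurry G)) (hG' : Continuous (Function.uncurry G'))
    (h : ∀ p y, HasFDerivAt (fun q => G q y) (G' p y) p) (p : P) :
    HasFDerivAt (fun q => ∫ y, f y • G q y ∂μ) (∫ y, f y • G' p y ∂μ) p := by
  obtain ⟨M, hM⟩ := ((isCompact_closedBall p 1).prod hfc).exists_bound_of_continuousOn
    hG'.continuousOn
  have hint : ∀ {X : Type _} [NormedAddCommGroup X] [NormedSpace ℝ X] (g : E → X),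
      Continuous g → Integrable (fun y => f y • g y) μ := fun g hg =>
    (hf.smul hg).integrable_of_hasCompactSupport hfc.smul_right
  refine hasFDerivAt_integral_of_dominated_of_fderiv_le (s := ball p 1)
    (bound := fun y => M * ‖f y‖) (F' := fun q y => f y • G' q y)
    (ball_mem_nhds p one_pos) (Eventually.of_forall fun q => ?_) ?_ ?_
    (Eventually.of_forall fun y q hq => ?_)
    ((hf.integrable_of_hasCompactSupport hfc).norm.const_mul M)
    (Eventually.of_forall fun y q _ => (h q y).const_smul _)
  · exact (hint (G q) (by fun_prop)).aestronglyMeasurable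
  · exact (hf.smul (by fun_prop)).integrable_of_hasCompactSupport hfc.smul_right
  · exact ((hf.smul (by fun_prop)).integrable_of_hasCompactSupport
      hfc.smul_right).aestronglyMeasurable
  · by_cases hy : y ∈ tsupport f
    · rw [norm_smul, mul_comm]
      exact mul_le_mul_of_nonneg_right (hM (q, y) ⟨ball_subset_closedBall hq, hy⟩) (norm_nonneg _)
    · simp [image_eq_zero_of_notMem_tsupport hy]

variable [NormedSpace ℝ E] [FiniteDimensional ℝ E]

theorem continuous_integral_smul_of_hasCompactSupport {f : E → ℝ} (hf : Continuous f)
    (hfc : HasCompactSupport f) {G : P → E → F} (hG : Continuous (Function.uncurry G)) :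
    Continuous fun p => ∫ y, f y • G p y ∂μ := by
  have h : ∀ p, ∫ y, f y • G p y ∂μ = ∫ y in tsupport f, f y • G p y ∂μ := by
    intro p
    rw [setIntegral_eq_integral_of_forall_compl_eq_zero]
    intro y hy
    rw [image_eq_zero_of_notMem_tsupport hy, zero_smul]
  simp_rw [h]
  exact continuous_parametric_integral_of_continuous (μ := μ)
    (f := fun p y => f y • G p y) (by fun_prop) hfc

theorem hasFDerivAt_integral_mul_comp_sub {f G : E → ℝ} (hf : Continuous f)
    (hfc : HasCompactSupport f) (hG : ContDiff ℝ 1 G) (x : E) :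
    HasFDerivAt (fun x => ∫ y, f y * G (x - y) ∂μ) (∫ y, f y • fderiv ℝ G (x - y) ∂μ) x := by
  have hG' : Continuous (fderiv ℝ G) := hG.continuous_fderiv one_ne_zero
  have hG0 := hG.continuous
  refine hasFDerivAt_integral_smul_of_hasCompactSupport hf hfc (G := fun x y => G (x - y))
    (G' := fun x y => fderiv ℝ G (x - y)) (by fun_prop) (by fun_prop) (fun q y => ?_) x
  simpa [Function.comp_def] using ((hG.differentiable one_ne_zero (q - y)).hasFDerivAt).comp q
    ((hasFDerivAt_id q).sub_const y)

theorem fderiv_integral_mul_comp_sub {f G : E → ℝ} (hf : Continuous f)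
    (hfc : HasCompactSupport f) (hG : ContDiff ℝ 1 G) (x v : E) :
    fderiv ℝ (fun x => ∫ y, f y * G (x - y) ∂μ) x v = ∫ y, f y * fderiv ℝ G (x - y) v ∂μ := by
  have hG' : Continuous (fderiv ℝ G) := hG.continuous_fderiv one_ne_zero
  rw [(hasFDerivAt_integral_mul_comp_sub hf hfc hG x).fderiv, ContinuousLinearMap.integral_apply]
  · rfl
  · exact (hf.smul (by fun_prop)).integrable_of_hasCompactSupport hfc.smul_right

theorem contDiff_integral_mul_comp_sub {f : E → ℝ} (hf : Continuous f)
    (hfc : HasCompactSupport f) {k : ℕ} {G : E → ℝ} (hG : ContDiff ℝ k G) :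
    ContDiff ℝ k (fun x => ∫ y, f y * G (x - y) ∂μ) := by
  induction k generalizing G with
  | zero =>
    have hG0 := hG.continuous
    exact contDiff_zero.2 (continuous_integral_smul_of_hasCompactSupport hf hfc
      (G := fun x y => G (x - y)) (by fun_prop))
  | succ k ih =>
    have hG1 : ContDiff ℝ 1 G := hG.of_le (by exact_mod_cast Nat.le_add_left 1 k)
    push_cast at hG ⊢
    rw [contDiff_succ_iff_fderiv_apply] at hG ⊢
    refine ⟨fun x => (hasFDerivAt_integral_mul_comp_sub hf hfc hG1 x).differentiableAt,
      by simp, fun v => ?_⟩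
    simp_rw [fderiv_integral_mul_comp_sub hf hfc hG1]
    exact ih (hG.2.2 v)

end ParametricIntegral

theorem lapl_integral_mul_comp_sub {d : ℕ} {f G : EuclideanSpace ℝ (Fin d) → ℝ}
    (hf : Continuous f) (hfc : HasCompactSupport f) (hG : ContDiff ℝ 2 G)
    (x : EuclideanSpace ℝ (Fin d)) :
    lapl d (fun x => ∫ y, f y * G (x - y)) x = ∫ y, f y * lapl d G (x - y) := by
  have hG1 : ContDiff ℝ 1 G := hG.of_le one_le_two
  have hv : ∀ v, ContDiff ℝ 1 fun y => fderiv ℝ G y v := fun v =>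
    (hG.fderiv_right (m := 1) (by norm_num [one_add_one_eq_two])).clm_apply contDiff_const
  unfold lapl
  simp_rw [fderiv_integral_mul_comp_sub hf hfc hG1, fderiv_integral_mul_comp_sub hf hfc (hv _),
    Finset.mul_sum]
  rw [integral_finsetSum]
  intro i _
  have := (hv (EuclideanSpace.single i 1)).continuous_fderiv one_ne_zero
  exact (hf.mul (by fun_prop)).integrable_of_hasCompactSupport hfc.mul_right

section Radial

variable {E : Type*} [NormedAddCommGroup E] [InnerProductSpace ℝ E]

theorem hasFDerivAt_comp_norm_sq {k : ℝ → ℝ} {k' : ℝ} {x : E} (h : HasDerivAt k k' (‖x‖ ^ 2)) :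
    HasFDerivAt (fun y : E => k (‖y‖ ^ 2)) (k' • (2 • innerSL ℝ x)) x :=
  h.comp_hasFDerivAt x (hasStrictFDerivAt_norm_sq x).hasFDerivAt

theorem fderiv_comp_norm_sq {k : ℝ → ℝ} (hk : Differentiable ℝ k) (x v : E) :
    fderiv ℝ (fun y : E => k (‖y‖ ^ 2)) x v = 2 * deriv k (‖x‖ ^ 2) * inner ℝ x v := by
  rw [(hasFDerivAt_comp_norm_sq (hk (‖x‖ ^ 2)).hasDerivAt).fderiv]
  simp
  ring

theorem hasCompactSupport_comp_norm_sq [FiniteDimensional ℝ E] {k : ℝ → ℝ} {r : ℝ}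
    (hk : ∀ s, r ^ 2 < s → k s = 0) (hr : 0 ≤ r) :
    HasCompactSupport fun x : E => k (‖x‖ ^ 2) := by
  refine HasCompactSupport.of_support_subset_isCompact (isCompact_closedBall 0 r) fun x hx => ?_
  by_contra h
  rw [mem_closedBall_zero_iff, not_le] at h
  exact hx (hk _ (by gcongr))

end Radial

theorem lapl_comp_norm_sq {d : ℕ} {k : ℝ → ℝ} (hk : ContDiff ℝ 2 k)
    (x : EuclideanSpace ℝ (Fin d)) :
    lapl d (fun y => k (‖y‖ ^ 2)) x =
      4 * ‖x‖ ^ 2 * deriv (deriv k) (‖x‖ ^ 2) + 2 * d * deriv k (‖x‖ ^ 2) := by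
  have hk1 : Differentiable ℝ k := hk.differentiable two_ne_zero
  have hk2 : ContDiff ℝ 1 (deriv k) := by
    rw [← one_add_one_eq_two, contDiff_succ_iff_deriv] at hk
    exact hk.2.2
  have hk2 : Differentiable ℝ (deriv k) := hk2.differentiable one_ne_zero
  have hi : ∀ i : Fin d,
      fderiv ℝ (fun y : EuclideanSpace ℝ (Fin d) =>
        fderiv ℝ (fun y => k (‖y‖ ^ 2)) y (EuclideanSpace.single i 1)) x
          (EuclideanSpace.single i 1) =
        4 * x i ^ 2 * deriv (deriv k) (‖x‖ ^ 2) + 2 * deriv k (‖x‖ ^ 2) := by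
    intro i
    simp_rw [fderiv_comp_norm_sq hk1]
    have h1 := (hasFDerivAt_comp_norm_sq (x := x) (hk2 (‖x‖ ^ 2)).hasDerivAt).const_mul 2
    have h2 : HasFDerivAt (fun y : EuclideanSpace ℝ (Fin d) =>
        inner ℝ y (EuclideanSpace.single i (1 : ℝ)))
        (innerSL ℝ (EuclideanSpace.single i (1 : ℝ))) x :=
      (innerSL ℝ (EuclideanSpace.single i (1 : ℝ))).hasFDerivAt.congr_of_eventuallyEq
        (Eventually.of_forall fun y => real_inner_comm _ _)
    have h : HasFDerivAt (fun y : EuclideanSpace ℝ (Fin d) =>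
        2 * deriv k (‖y‖ ^ 2) * inner ℝ y (EuclideanSpace.single i (1 : ℝ))) _ x := h1.mul h2
    rw [h.fderiv]
    simp [EuclideanSpace.inner_single_right]
    ring
  unfold lapl
  simp_rw [hi]
  rw [Finset.sum_add_distrib, EuclideanSpace.real_norm_sq_eq, ← Finset.sum_mul, ← Finset.mul_sum]
  simp
  ring

/-- A smooth profile agreeing with `s ^ (1 - d / 2)` for `s ≥ 1 / 64` and vanishing near `0`,
so that `newtonProfile d (‖x‖ ^ 2)` is a smooth regularization of the Newtonian kernel. -/
def newtonProfile (d : ℕ) (s : ℝ) : ℝ :=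
  Real.smoothTransition (128 * s - 1) * s ^ (1 - (d : ℝ) / 2)

/-- The profile of the Laplacian of `newtonProfile d (‖x‖ ^ 2)`. -/
def bumpProfile (d : ℕ) (s : ℝ) : ℝ :=
  4 * s * deriv (deriv (newtonProfile d)) s + 2 * d * deriv (newtonProfile d) s

/-- A primitive of `bumpProfile d` vanishing for `s ≥ 1 / 64`. -/
def bumpPrimitive (d : ℕ) (s : ℝ) : ℝ :=
  4 * s * deriv (newtonProfile d) s + 2 * (d - 2) * newtonProfile d s

theorem contDiff_newtonProfile (d : ℕ) {k : ℕ∞} : ContDiff ℝ k (newtonProfile d) := by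
  rw [contDiff_iff_contDiffAt]
  intro s
  rcases lt_or_ge s (1 / 128) with hs | hs
  · refine (contDiffAt_const (c := (0 : ℝ))).congr_of_eventuallyEq ?_
    filter_upwards [gt_mem_nhds hs] with t ht
    rw [newtonProfile, Real.smoothTransition.zero_of_nonpos (by linarith), zero_mul]
  · refine ContDiffAt.mul ?_ ?_
    · exact Real.smoothTransition.contDiffAt.comp s (by fun_prop)
    · exact Real.contDiffAt_rpow_const_of_ne (by linarith)

theorem newtonProfile_of_le {d : ℕ} {s : ℝ} (hs : 1 / 64 ≤ s) :
    newtonProfile d s = s ^ (1 - (d : ℝ) / 2) := by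
  rw [newtonProfile, Real.smoothTransition.one_of_one_le (by linarith), one_mul]

theorem deriv_newtonProfile_of_lt {d : ℕ} {s : ℝ} (hs : 1 / 64 < s) :
    deriv (newtonProfile d) s = (1 - (d : ℝ) / 2) * s ^ (-(d : ℝ) / 2) := by
  have h : newtonProfile d =ᶠ[nhds s] fun t => t ^ (1 - (d : ℝ) / 2) := by
    filter_upwards [lt_mem_nhds hs] with t ht using newtonProfile_of_le ht.le
  rw [h.deriv_eq, Real.deriv_rpow_const]
  ring_nf

theorem contDiff_deriv_newtonProfile (d : ℕ) {k : ℕ∞} :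
    ContDiff ℝ k (deriv (newtonProfile d)) := by
  have h := contDiff_newtonProfile d (k := k + 1)
  push_cast at h
  rw [contDiff_succ_iff_deriv] at h
  exact h.2.2

theorem contDiff_deriv_deriv_newtonProfile (d : ℕ) {k : ℕ∞} :
    ContDiff ℝ k (deriv (deriv (newtonProfile d))) := by
  have h := contDiff_deriv_newtonProfile d (k := k + 1)
  push_cast at h
  rw [contDiff_succ_iff_deriv] at h
  exact h.2.2

theorem differentiable_newtonProfile (d : ℕ) : Differentiable ℝ (newtonProfile d) :=
  (contDiff_newtonProfile d (k := 1)).differentiable one_ne_zero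

theorem differentiable_deriv_newtonProfile (d : ℕ) : Differentiable ℝ (deriv (newtonProfile d)) :=
  (contDiff_deriv_newtonProfile d (k := 1)).differentiable one_ne_zero

theorem contDiff_bumpProfile (d : ℕ) {k : ℕ∞} : ContDiff ℝ k (bumpProfile d) :=
  ((contDiff_const.mul contDiff_id).mul (contDiff_deriv_deriv_newtonProfile d)).add
    (contDiff_const.mul (contDiff_deriv_newtonProfile d))

theorem contDiff_bumpPrimitive (d : ℕ) {k : ℕ∞} : ContDiff ℝ k (bumpPrimitive d) :=
  ((contDiff_const.mul contDiff_id).mul (contDiff_deriv_newtonProfile d)).add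
    (contDiff_const.mul (contDiff_newtonProfile d))

theorem deriv_bumpPrimitive (d : ℕ) : deriv (bumpPrimitive d) = bumpProfile d := by
  ext s
  have h1 := (differentiable_newtonProfile d s).hasDerivAt
  have h2 := (differentiable_deriv_newtonProfile d s).hasDerivAt
  have h : HasDerivAt (bumpPrimitive d) _ s :=
    (((hasDerivAt_id s).const_mul 4).mul h2).add (h1.const_mul (2 * ((d : ℝ) - 2)))
  rw [h.deriv, bumpProfile]
  simp only [id]
  ring

theorem bumpPrimitive_of_lt {d : ℕ} {s : ℝ} (hs : 1 / 64 < s) : bumpPrimitive d s = 0 := by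
  have h0 : 0 < s := by linarith
  have h : s ^ (1 - (d : ℝ) / 2) = s * s ^ (-(d : ℝ) / 2) := by
    rw [sub_eq_add_neg, Real.rpow_add h0, Real.rpow_one, neg_div]
  rw [bumpPrimitive, deriv_newtonProfile_of_lt hs, newtonProfile_of_le hs.le, h]
  ring

theorem bumpProfile_of_lt {d : ℕ} {s : ℝ} (hs : 1 / 64 < s) : bumpProfile d s = 0 := by
  rw [← deriv_bumpPrimitive]
  have h : bumpPrimitive d =ᶠ[nhds s] fun _ => 0 := by
    filter_upwards [lt_mem_nhds hs] with t ht using bumpPrimitive_of_lt ht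
  simp [h.deriv_eq]

/-- A smooth regularization of the kernel `‖x‖ ^ (2 - d)`. -/
def newtonKernel (d : ℕ) (x : EuclideanSpace ℝ (Fin d)) : ℝ := newtonProfile d (‖x‖ ^ 2)

/-- The Laplacian of `newtonKernel d`, a smooth radial function supported in `‖x‖ ≤ 1 / 8`. -/
def radialBump (d : ℕ) (x : EuclideanSpace ℝ (Fin d)) : ℝ := bumpProfile d (‖x‖ ^ 2)

theorem contDiff_newtonKernel (d : ℕ) {k : ℕ∞} : ContDiff ℝ k (newtonKernel d) :=
  (contDiff_newtonProfile d).comp (contDiff_norm_sq ℝ)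

theorem contDiff_radialBump (d : ℕ) {k : ℕ∞} : ContDiff ℝ k (radialBump d) :=
  (contDiff_bumpProfile d).comp (contDiff_norm_sq ℝ)

theorem hasCompactSupport_radialBump (d : ℕ) : HasCompactSupport (radialBump d) :=
  hasCompactSupport_comp_norm_sq (r := 1 / 8) (fun _ hs => bumpProfile_of_lt (by linarith))
    (by norm_num)

theorem radialBump_of_lt {d : ℕ} {x : EuclideanSpace ℝ (Fin d)} (hx : 1 / 8 < ‖x‖) :
    radialBump d x = 0 :=
  bumpProfile_of_lt (by nlinarith)

theorem lapl_newtonKernel (d : ℕ) : lapl d (newtonKernel d) = radialBump d :=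
  funext fun x => lapl_comp_norm_sq (contDiff_newtonProfile d) x

theorem integral_radialBump_ne_zero {d : ℕ} (hd : 3 ≤ d) : ∫ x, radialBump d x ≠ 0 := by
  have : Nonempty (Fin d) := ⟨⟨0, by omega⟩⟩
  have h1 := integral_fun_norm_addHaar (volume : Measure (EuclideanSpace ℝ (Fin d)))
    fun r => bumpProfile d (r ^ 2)
  rw [finrank_euclideanSpace_fin] at h1
  have h2 : ∫ r in Ioi (0 : ℝ), r ^ (d - 1) • bumpProfile d (r ^ 2) = 2 - d := by
    have hderiv : ∀ r ∈ Ici (0 : ℝ), HasDerivAt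
        (fun r => 2 * r ^ d * deriv (newtonProfile d) (r ^ 2))
        (r ^ (d - 1) • bumpProfile d (r ^ 2)) r := by
      intro r _
      have h := ((hasDerivAt_pow d r).const_mul 2).mul
        ((differentiable_deriv_newtonProfile d (r ^ 2)).hasDerivAt.comp r (hasDerivAt_pow 2 r))
      refine h.congr_deriv ?_
      obtain ⟨e, rfl⟩ : ∃ e, d = e + 1 := ⟨d - 1, by omega⟩
      simp only [bumpProfile, smul_eq_mul, Nat.add_sub_cancel, pow_succ, Function.comp]
      push_cast
      ring
    have hc : ∀ r : ℝ, 1 / 8 < r → 2 * r ^ d * deriv (newtonProfile d) (r ^ 2) = 2 - d := by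
      intro r hr
      have hr0 : 0 < r := by linarith
      rw [deriv_newtonProfile_of_lt (by nlinarith), ← Real.rpow_natCast r 2,
        ← Real.rpow_mul hr0.le]
      have : ((2 : ℕ) : ℝ) * (-(d : ℝ) / 2) = -(d : ℝ) := by push_cast; ring
      rw [this, Real.rpow_neg hr0.le, Real.rpow_natCast]
      field_simp
    rw [integral_Ioi_of_hasDerivAt_of_tendsto' (m := 2 - (d : ℝ)) hderiv]
    · simp [show d ≠ 0 by omega]
    · refine Continuous.integrable_of_hasCompactSupport ?_ ?_ |>.integrableOn
      · have := (contDiff_bumpProfile d (k := 0)).continuous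
        simp only [smul_eq_mul]
        fun_prop
      · have := hasCompactSupport_comp_norm_sq (E := ℝ) (k := bumpProfile d) (r := 1 / 8)
          (fun _ hs => bumpProfile_of_lt (by linarith)) (by norm_num)
        simp only [Real.norm_eq_abs, sq_abs] at this
        exact this.mul_left
    · refine tendsto_const_nhds.congr' ?_
      filter_upwards [eventually_gt_atTop (1 / 8)] with r hr using (hc r hr).symm
  have h3 : (2 : ℝ) - d ≠ 0 := by
    have : (3 : ℝ) ≤ d := by exact_mod_cast hd
    linarith
  have h4 : (volume : Measure (EuclideanSpace ℝ (Fin d))).real (ball 0 1) ≠ 0 :=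
    (ENNReal.toReal_pos (measure_ball_pos _ _ one_pos).ne' measure_ball_lt_top.ne).ne'
  unfold radialBump
  rw [h1, h2, nsmul_eq_mul, smul_eq_mul]
  exact mul_ne_zero (by exact_mod_cast (by omega : d ≠ 0)) (mul_ne_zero h4 h3)

theorem fderiv_comp_sub_smul {E : Type*} [NormedAddCommGroup E] [NormedSpace ℝ E] {f : E → ℝ}
    (hf : Differentiable ℝ f) (x : E) (r : ℝ) (y v : E) :
    fderiv ℝ (fun z => f (x - r • z)) y v = -(r * fderiv ℝ f (x - r • y) v) := by
  have h : HasFDerivAt (fun z => f (x - r • z)) _ y :=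
    (hf (x - r • y)).hasFDerivAt.comp y (((hasFDerivAt_id y).const_smul r).const_sub x)
  rw [h.fderiv]
  simp

theorem integral_mul_fderiv_comp_sub_smul {d : ℕ} {f g : EuclideanSpace ℝ (Fin d) → ℝ}
    (hf : ContDiff ℝ 1 f) (hg : ContDiff ℝ 1 g) (hgc : HasCompactSupport g)
    (x : EuclideanSpace ℝ (Fin d)) (r : ℝ) (v : EuclideanSpace ℝ (Fin d)) :
    ∫ y, fderiv ℝ g y v * f (x - r • y) = r * ∫ y, g y * fderiv ℝ f (x - r • y) v := by
  have hf0 := hf.continuous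
  have hg0 := hg.continuous
  have hf1 := hf.continuous_fderiv one_ne_zero
  have hg1 := hg.continuous_fderiv one_ne_zero
  have hfd := hf.differentiable one_ne_zero
  have hgd := hg.differentiable one_ne_zero
  have hF : Differentiable ℝ fun y => f (x - r • y) := hfd.comp (by fun_prop)
  have hgv : HasCompactSupport fun y => fderiv ℝ g y v := hgc.fderiv_apply ℝ v
  have hparts := integral_mul_fderiv_eq_neg_fderiv_mul_of_integrable (μ := volume) (f := g)
    (g := fun y => f (x - r • y)) (v := v)
    (Continuous.integrable_of_hasCompactSupport (by fun_prop) hgv.mul_right)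
    (by
      simp_rw [fderiv_comp_sub_smul hfd]
      exact Continuous.integrable_of_hasCompactSupport (by fun_prop) hgc.mul_right)
    (Continuous.integrable_of_hasCompactSupport (by fun_prop) hgc.mul_right)
    (fun y _ => hgd y) (fun y _ => hF y)
  rw [eq_neg_iff_add_eq_zero, add_comm, ← eq_neg_iff_add_eq_zero] at hparts
  rw [hparts, ← integral_neg, ← integral_const_mul]
  refine integral_congr_ae (Eventually.of_forall fun y => ?_)
  simp only [fderiv_comp_sub_smul hfd]
  ring

theorem contDiff_fderiv_apply_of_two {d : ℕ} {f : EuclideanSpace ℝ (Fin d) → ℝ}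
    (hf : ContDiff ℝ 2 f) (v : EuclideanSpace ℝ (Fin d)) :
    ContDiff ℝ 1 fun y => fderiv ℝ f y v :=
  (hf.fderiv_right (m := 1) (by norm_num [one_add_one_eq_two])).clm_apply contDiff_const

theorem integral_radialBump_mul_fderiv {d : ℕ} {f : EuclideanSpace ℝ (Fin d) → ℝ}
    (hf : ContDiff ℝ 2 f) {x : EuclideanSpace ℝ (Fin d)} {r : ℝ}
    (hlap : ∀ y, ‖y‖ ≤ 1 / 8 → lapl d f (x - r • y) = 0) :
    ∫ y, radialBump d y * fderiv ℝ f (x - r • y) y = 0 := by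
  set ζ : EuclideanSpace ℝ (Fin d) → ℝ := fun y => bumpPrimitive d (‖y‖ ^ 2) with hζ
  have hζsmooth : ContDiff ℝ 1 ζ := (contDiff_bumpPrimitive d (k := 1)).comp (contDiff_norm_sq ℝ)
  have hζc : HasCompactSupport ζ :=
    hasCompactSupport_comp_norm_sq (r := 1 / 8) (fun _ hs => bumpPrimitive_of_lt (by linarith))
      (by norm_num)
  have hζd : ∀ (y : EuclideanSpace ℝ (Fin d)) (i : Fin d),
      fderiv ℝ ζ y (EuclideanSpace.single i 1) = 2 * (radialBump d y * y i) := by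
    intro y i
    rw [hζ, fderiv_comp_norm_sq ((contDiff_bumpPrimitive d (k := 1)).differentiable one_ne_zero),
      deriv_bumpPrimitive, EuclideanSpace.inner_single_right, radialBump]
    simp
    ring
  have hf1 := contDiff_fderiv_apply_of_two hf
  have hf1c := fun v => (hf1 v).continuous
  have hf2c := fun v => (hf1 v).continuous_fderiv one_ne_zero
  have hη := (contDiff_radialBump d (k := 1)).continuous
  have hζ0 := hζsmooth.continuous
  have hexp : ∀ y, radialBump d y * fderiv ℝ f (x - r • y) y =
      ∑ i : Fin d, (1 / 2) * (fderiv ℝ ζ y (EuclideanSpace.single i 1) *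
        fderiv ℝ f (x - r • y) (EuclideanSpace.single i 1)) := by
    intro y
    have hy : y = ∑ i : Fin d, y i • EuclideanSpace.single i (1 : ℝ) := by
      ext j
      simp [Finset.sum_apply, Pi.single_apply]
    conv_lhs => rw [hy, map_sum, Finset.mul_sum]
    rw [← hy]
    refine Finset.sum_congr rfl fun i _ => ?_
    rw [hζd, map_smul, smul_eq_mul]
    ring
  simp_rw [hexp]
  rw [integral_finsetSum]
  · simp_rw [integral_const_mul, integral_mul_fderiv_comp_sub_smul (hf1 _) hζsmooth hζc]
    rw [← Finset.mul_sum, ← Finset.mul_sum, ← integral_finsetSum]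
    · have hz : ∀ y, ∑ i : Fin d, ζ y * fderiv ℝ
          (fun y => fderiv ℝ f y (EuclideanSpace.single i 1)) (x - r • y)
          (EuclideanSpace.single i 1) = 0 := by
        intro y
        rw [← Finset.mul_sum]
        rcases le_or_gt ‖y‖ (1 / 8) with hy | hy
        · exact mul_eq_zero_of_right _ (hlap y hy)
        · exact mul_eq_zero_of_left (bumpPrimitive_of_lt (by nlinarith)) _
      simp [hz]
    · intro i _
      exact Continuous.integrable_of_hasCompactSupport (by fun_prop) hζc.mul_right
  · intro i _
    have := hζsmooth.continuous_fderiv one_ne_zero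
    exact (Continuous.integrable_of_hasCompactSupport (by fun_prop)
      (hζc.fderiv_apply ℝ _).mul_right).const_mul _

/-- Mean value property for averages against a radial bump function. -/
theorem integral_radialBump_mul_comp_sub_smul {d : ℕ} {f : EuclideanSpace ℝ (Fin d) → ℝ}
    (hf : ContDiff ℝ 2 f) {x : EuclideanSpace ℝ (Fin d)} {R : ℝ} (hR : 0 ≤ R)
    (hlap : ∀ z, ‖z - x‖ ≤ R / 8 → lapl d f z = 0) :
    ∫ y, radialBump d y * f (x - R • y) = (∫ y, radialBump d y) * f x := by
  have hη := (contDiff_radialBump d (k := 1)).continuous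
  have hfd : Differentiable ℝ f := hf.differentiable two_ne_zero
  have hf0 := hf.continuous
  have hf1 := hf.continuous_fderiv two_ne_zero
  have hderiv : ∀ r : ℝ, HasDerivAt (fun r : ℝ => ∫ y, radialBump d y * f (x - r • y))
      (-∫ y, radialBump d y * fderiv ℝ f (x - r • y) y) r := by
    intro r
    have h := (hasFDerivAt_integral_smul_of_hasCompactSupport (μ := volume) hη
      (hasCompactSupport_radialBump d) (G := fun (r : ℝ) y => f (x - r • y))
      (G' := fun (r : ℝ) y => (1 : ℝ →L[ℝ] ℝ).smulRight
        (-fderiv ℝ f (x - r • y) y)) (by fun_prop) (by fun_prop) (fun q y => ?_) r).hasDerivAt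
    · refine h.congr_deriv ?_
      rw [ContinuousLinearMap.integral_apply]
      · simp [integral_neg]
      · exact Continuous.integrable_of_hasCompactSupport (by fun_prop)
          (hasCompactSupport_radialBump d).smul_right
    · have h1 : HasDerivAt (fun q : ℝ => x - q • y) (-y) q := by
        simpa using ((hasDerivAt_id q).smul_const y).const_sub x
      have h2 := (hfd (x - q • y)).hasFDerivAt.comp_hasDerivAt q h1
      refine h2.hasFDerivAt.congr_fderiv ?_
      ext
      simp
  have hzero : ∀ r ∈ Ico 0 R, ∫ y, radialBump d y * fderiv ℝ f (x - r • y) y = 0 := by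
    intro r hr
    refine integral_radialBump_mul_fderiv hf fun y hy => hlap _ ?_
    rw [sub_sub_cancel_left, norm_neg, norm_smul, Real.norm_of_nonneg hr.1]
    nlinarith [hr.1, hr.2, norm_nonneg y]
  have hconst := constant_of_has_deriv_right_zero
    (f := fun r : ℝ => ∫ y, radialBump d y * f (x - r • y)) (a := 0) (b := R)
    (fun r _ => (hderiv r).continuousAt.continuousWithinAt)
    (fun r hr => by
      have := (hderiv r).hasDerivWithinAt (s := Ici r)
      rwa [hzero r hr, neg_zero] at this) R (right_mem_Icc.2 hR)
  rw [hconst]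
  simp [integral_mul_const]

section Reweight

variable {d : ℕ}

/-- The polynomial obtained from `p` by multiplying the coefficient of each monomial `α`
by `w α`. -/
def reweight (p : MvPolynomial (Fin d) ℝ) (w : (Fin d →₀ ℕ) → ℝ) : MvPolynomial (Fin d) ℝ :=
  ∑ α ∈ p.support, MvPolynomial.monomial α (w α * p.coeff α)

theorem totalDegree_reweight_le (p : MvPolynomial (Fin d) ℝ) (w : (Fin d →₀ ℕ) → ℝ) :
    (reweight p w).totalDegree ≤ p.totalDegree :=
  MvPolynomial.totalDegree_finsetSum_le fun _ hα =>
    (MvPolynomial.totalDegree_monomial_le _ _).trans (MvPolynomial.le_totalDegree hα)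

theorem pev_reweight (p : MvPolynomial (Fin d) ℝ) (w : (Fin d →₀ ℕ) → ℝ)
    (x : EuclideanSpace ℝ (Fin d)) :
    pev (reweight p w) x = ∑ α ∈ p.support, w α * p.coeff α * ∏ i, x i ^ α i := by
  rw [pev, reweight, map_sum]
  refine Finset.sum_congr rfl fun α _ => ?_
  rw [MvPolynomial.eval_monomial, Finsupp.prod_fintype _ _ fun i => pow_zero _]

theorem pev_eq (p : MvPolynomial (Fin d) ℝ) (x : EuclideanSpace ℝ (Fin d)) :
    pev p x = ∑ α ∈ p.support, p.coeff α * ∏ i, x i ^ α i :=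
  MvPolynomial.eval_eq' _ _

end Reweight

theorem contDiff_pev {d : ℕ} (p : MvPolynomial (Fin d) ℝ) {k : WithTop ℕ∞} :
    ContDiff ℝ k (pev p) := by
  simp_rw [funext (pev_eq p)]
  fun_prop

/-- A differentiable function all of whose partial derivatives are polynomials of degree at most
`m` is a polynomial of degree at most `m + 1`. -/
theorem exists_pev_eq_of_fderiv {d m : ℕ} {f : EuclideanSpace ℝ (Fin d) → ℝ}
    (hf : Differentiable ℝ f) {q : Fin d → MvPolynomial (Fin d) ℝ}
    (hq : ∀ i, (q i).totalDegree ≤ m)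
    (h : ∀ i x, fderiv ℝ f x (EuclideanSpace.single i 1) = pev (q i) x) :
    ∃ p : MvPolynomial (Fin d) ℝ, p.totalDegree ≤ m + 1 ∧ ∀ x, f x = pev p x := by
  let w : (Fin d →₀ ℕ) → ℝ := fun α => ((∑ i, α i : ℕ) + 1 : ℝ)⁻¹
  let P : MvPolynomial (Fin d) ℝ :=
    MvPolynomial.C (f 0) + ∑ i, MvPolynomial.X i * reweight (q i) w
  refine ⟨P, ?_, fun x => ?_⟩
  · refine (MvPolynomial.totalDegree_add _ _).trans (max_le ?_ ?_)
    · rw [MvPolynomial.totalDegree_C]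
      exact Nat.zero_le _
    · refine MvPolynomial.totalDegree_finsetSum_le fun i _ => ?_
      refine (MvPolynomial.totalDegree_mul _ _).trans ?_
      rw [MvPolynomial.totalDegree_X, add_comm]
      exact Nat.add_le_add_right ((totalDegree_reweight_le _ _).trans (hq i)) 1
  · have hP : ∀ t : ℝ, pev P (t • x) = f 0 + ∑ i, x i * ∑ α ∈ (q i).support,
        w α * (q i).coeff α * (∏ j, x j ^ α j) * t ^ (∑ j, α j + 1) := by
      intro t
      have : pev P (t • x) = f 0 + ∑ i, (t • x) i * pev (reweight (q i) w) (t • x) := by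
        simp [pev, P]
      rw [this]
      congr 1
      refine Finset.sum_congr rfl fun i _ => ?_
      rw [pev_reweight, Finset.mul_sum, Finset.mul_sum]
      refine Finset.sum_congr rfl fun α _ => ?_
      simp only [PiLp.smul_apply, smul_eq_mul, mul_pow, Finset.prod_mul_distrib,
        Finset.prod_pow_eq_pow_sum]
      ring
    have hPd : ∀ t : ℝ, HasDerivAt (fun t : ℝ => pev P (t • x))
        (∑ i, x i * pev (q i) (t • x)) t := by
      intro t
      simp_rw [hP]
      refine HasDerivAt.const_add _ (HasDerivAt.fun_sum fun i _ => HasDerivAt.const_mul _ ?_)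
      rw [pev_eq]
      refine HasDerivAt.fun_sum fun α _ => ?_
      refine ((hasDerivAt_pow (∑ j, α j + 1) t).const_mul _).congr_deriv ?_
      have hw : w α * ((∑ j, α j + 1 : ℕ) : ℝ) = 1 := by
        simp only [w]
        push_cast
        exact inv_mul_cancel₀ (by positivity)
      simp only [PiLp.smul_apply, smul_eq_mul, mul_pow, Finset.prod_mul_distrib,
        Finset.prod_pow_eq_pow_sum, Nat.add_sub_cancel]
      linear_combination ((q i).coeff α * (∏ j, x j ^ α j) * t ^ ∑ j, α j) * hw
    have hfd : ∀ t : ℝ, HasDerivAt (fun t : ℝ => f (t • x))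
        (∑ i, x i * pev (q i) (t • x)) t := by
      intro t
      have h1 := (hf (t • x)).hasFDerivAt.comp_hasDerivAt t ((hasDerivAt_id t).smul_const x)
      refine h1.congr_deriv ?_
      have hx : x = ∑ i : Fin d, x i • EuclideanSpace.single i (1 : ℝ) := by
        ext j
        simp [Finset.sum_apply, Pi.single_apply]
      rw [one_smul]
      conv_lhs => rw [hx, map_sum]
      rw [← hx]
      exact Finset.sum_congr rfl fun i _ => by rw [map_smul, h, smul_eq_mul]
    have hdiff : ∀ t : ℝ, HasDerivAt (fun t : ℝ => f (t • x) - pev P (t • x)) 0 t := fun t =>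
      ((hfd t).sub (hPd t)).congr_deriv (sub_self _)
    have := is_const_of_deriv_eq_zero (fun t => (hdiff t).differentiableAt)
      (fun t => (hdiff t).deriv) 1 0
    have h0 : pev P ((0 : ℝ) • x) = f 0 := by
      rw [hP]
      simp
    rw [h0] at this
    simp only [one_smul, zero_smul] at this
    linarith

theorem contDiff_integral_radialBump_mul {d : ℕ} {f : EuclideanSpace ℝ (Fin d) → ℝ}
    (hf : Continuous f) {k : ℕ∞} : ContDiff ℝ k fun x => ∫ y, radialBump d y * f (x - y) :=
  (hasCompactSupport_radialBump d).contDiff_convolution_left (ContinuousLinearMap.mul ℝ ℝ)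
    (contDiff_radialBump d) hf.locallyIntegrable

/-- Entire harmonic functions are smooth. -/
theorem contDiff_of_lapl_eq_zero {d : ℕ} (hd : 3 ≤ d) {f : EuclideanSpace ℝ (Fin d) → ℝ}
    (hf : ContDiff ℝ 2 f) (hlap : ∀ x, lapl d f x = 0) {k : ℕ∞} : ContDiff ℝ k f := by
  have h : f = fun x => (∫ y, radialBump d y)⁻¹ * ∫ y, radialBump d y * f (x - y) := by
    ext x
    have := integral_radialBump_mul_comp_sub_smul hf (x := x) zero_le_one fun z _ => hlap z
    simp_rw [one_smul] at this
    rw [this, inv_mul_cancel_left₀ (integral_radialBump_ne_zero hd)]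
  rw [h]
  exact contDiff_const.mul (contDiff_integral_radialBump_mul hf.continuous)

theorem fderiv_fderiv_apply_comm {d : ℕ} {f : EuclideanSpace ℝ (Fin d) → ℝ}
    (hf : ContDiff ℝ 2 f) (v w x : EuclideanSpace ℝ (Fin d)) :
    fderiv ℝ (fun y => fderiv ℝ f y v) x w = fderiv ℝ (fun y => fderiv ℝ f y w) x v := by
  have hd : DifferentiableAt ℝ (fderiv ℝ f) x :=
    (hf.fderiv_right (m := 1) (by norm_num [one_add_one_eq_two])).differentiable one_ne_zero x
  have hsymm : IsSymmSndFDerivAt ℝ f x := hf.contDiffAt.isSymmSndFDerivAt (by simp)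
  rw [fderiv_clm_apply hd (differentiableAt_const v), fderiv_clm_apply hd (differentiableAt_const w)]
  simpa using hsymm w v

theorem lapl_fderiv_apply {d : ℕ} {f : EuclideanSpace ℝ (Fin d) → ℝ} (hf : ContDiff ℝ 3 f)
    (v x : EuclideanSpace ℝ (Fin d)) :
    lapl d (fun y => fderiv ℝ f y v) x = fderiv ℝ (lapl d f) x v := by
  have hf2 : ContDiff ℝ 2 f := hf.of_le (by norm_num)
  have hfv : ∀ v, ContDiff ℝ 2 fun y => fderiv ℝ f y v := fun v =>
    (hf.fderiv_right (m := 2) (by norm_num)).clm_apply contDiff_const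
  unfold lapl
  rw [fderiv_fun_sum fun i _ =>
    (contDiff_fderiv_apply_of_two (hfv _) _).differentiable one_ne_zero x, _root_.sum_apply]
  refine Finset.sum_congr rfl fun i _ => ?_
  simp_rw [fderiv_fderiv_apply_comm hf2 v]
  exact fderiv_fderiv_apply_comm (hfv _) v _ x

/-- Gradient estimate for entire harmonic functions. -/
theorem exists_abs_fderiv_le {d : ℕ} (hd : 3 ≤ d) (v : EuclideanSpace ℝ (Fin d)) :
    ∃ A : ℝ, 0 ≤ A ∧ ∀ f : EuclideanSpace ℝ (Fin d) → ℝ, ContDiff ℝ 2 f →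
      (∀ x, lapl d f x = 0) → ∀ (x : EuclideanSpace ℝ (Fin d)) (R M : ℝ), 0 < R →
      (∀ z, ‖z - x‖ ≤ R → |f z| ≤ M) → |fderiv ℝ f x v| ≤ A * M / R := by
  have hη := contDiff_radialBump d (k := 1)
  have hηc := hasCompactSupport_radialBump d
  have hη0 := hη.continuous
  have hη1 := hη.continuous_fderiv one_ne_zero
  have hc := integral_radialBump_ne_zero hd
  set c := ∫ y, radialBump d y with hcdef
  refine ⟨|c|⁻¹ * ∫ y, |fderiv ℝ (radialBump d) y v|, by positivity, ?_⟩
  intro f hf hlap x R M hR hM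
  have hf1 := (contDiff_fderiv_apply_of_two hf v).continuous
  have hf0 := hf.continuous
  have hmean : ∫ y, radialBump d y * fderiv ℝ f (x - R • y) v = c * fderiv ℝ f x v := by
    have hf3 : ContDiff ℝ 3 f := contDiff_of_lapl_eq_zero hd hf hlap
    have hfv : ContDiff ℝ 2 fun y => fderiv ℝ f y v :=
      (hf3.fderiv_right (m := 2) (by norm_num)).clm_apply contDiff_const
    refine integral_radialBump_mul_comp_sub_smul hfv hR.le fun z _ => ?_
    rw [lapl_fderiv_apply hf3, show lapl d f = fun _ => 0 from funext hlap]
    simp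
  have hparts := integral_mul_fderiv_comp_sub_smul (hf.of_le one_le_two) hη hηc x R v
  rw [hmean] at hparts
  have hbound : |∫ y, fderiv ℝ (radialBump d) y v * f (x - R • y)| ≤
      (∫ y, |fderiv ℝ (radialBump d) y v|) * M := by
    rw [← integral_mul_const]
    refine (abs_integral_le_integral_abs).trans (integral_mono ?_ ?_ fun y => ?_)
    · refine (Continuous.integrable_of_hasCompactSupport (by fun_prop)
        (hηc.fderiv_apply ℝ v).mul_right).abs
    · exact ((Continuous.integrable_of_hasCompactSupport (by fun_prop)
        (hηc.fderiv_apply ℝ v)).abs).mul_const _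
    · simp only [abs_mul]
      rcases le_or_gt ‖y‖ 1 with hy | hy
      · refine mul_le_mul_of_nonneg_left (hM _ ?_) (abs_nonneg _)
        rw [sub_sub_cancel_left, norm_neg, norm_smul, Real.norm_of_nonneg hR.le]
        exact mul_le_of_le_one_right hR.le hy
      · have : radialBump d =ᶠ[nhds y] fun _ => 0 := by
          filter_upwards [continuous_norm.continuousAt.eventually (lt_mem_nhds hy)] with z hz
          exact radialBump_of_lt (by linarith)
        simp [this.fderiv_eq]
  rw [hparts, abs_mul, abs_mul, abs_of_pos hR] at hbound
  rw [le_div_iff₀ hR, mul_assoc, inv_mul_eq_div, le_div_iff₀ (abs_pos.2 hc)]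
  linarith

/-- **Liouville's theorem**: entire harmonic functions of polynomial growth are polynomials. -/
theorem exists_pev_eq_of_lapl_eq_zero {d : ℕ} (hd : 3 ≤ d) (m : ℕ)
    {f : EuclideanSpace ℝ (Fin d) → ℝ} (hf : ContDiff ℝ 2 f) (hlap : ∀ x, lapl d f x = 0)
    {B : ℝ} (hB : ∀ x, |f x| ≤ B * (1 + ‖x‖) ^ m) :
    ∃ p : MvPolynomial (Fin d) ℝ, p.totalDegree ≤ m ∧ ∀ x, f x = pev p x := by
  have hfd : Differentiable ℝ f := hf.differentiable two_ne_zero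
  induction m generalizing f B with
  | zero =>
    have hzero : ∀ x v, fderiv ℝ f x v = 0 := by
      intro x v
      obtain ⟨A, -, hA⟩ := exists_abs_fderiv_le hd v
      have hlim : Tendsto (fun R : ℝ => A * B / R) atTop (nhds 0) :=
        tendsto_const_nhds.div_atTop tendsto_id
      have : |fderiv ℝ f x v| ≤ 0 := by
        refine ge_of_tendsto hlim ?_
        filter_upwards [eventually_gt_atTop 0] with R hR
        exact hA f hf hlap x R B hR fun z _ => by simpa using hB z
      exact abs_nonpos_iff.1 this
    refine ⟨MvPolynomial.C (f 0), by simp, fun x => ?_⟩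
    rw [is_const_of_fderiv_eq_zero hfd (fun x => by ext v; simp [hzero]) x 0]
    simp [pev]
  | succ m ih =>
    have hf3 : ContDiff ℝ 3 f := contDiff_of_lapl_eq_zero hd hf hlap
    have hpart : ∀ i : Fin d, ∃ q : MvPolynomial (Fin d) ℝ, q.totalDegree ≤ m ∧
        ∀ x, fderiv ℝ f x (EuclideanSpace.single i 1) = pev q x := by
      intro i
      obtain ⟨A, hA0, hA⟩ := exists_abs_fderiv_le hd (EuclideanSpace.single i (1 : ℝ))
      have hfv : ContDiff ℝ 2 fun y => fderiv ℝ f y (EuclideanSpace.single i 1) :=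
        (hf3.fderiv_right (m := 2) (by norm_num)).clm_apply contDiff_const
      refine ih hfv (fun x => ?_) (B := A * B * 2 ^ (m + 1)) (fun x => ?_)
        (hfv.differentiable two_ne_zero)
      · rw [lapl_fderiv_apply hf3, show lapl d f = fun _ => 0 from funext hlap]
        simp
      · have hx : 0 < 1 + ‖x‖ := by positivity
        have hB0 : 0 ≤ B := by simpa using (abs_nonneg _).trans (hB 0)
        refine (hA f hf hlap x (1 + ‖x‖) (B * (2 * (1 + ‖x‖)) ^ (m + 1)) hx fun z hz => ?_).trans
          (le_of_eq ?_)
        · refine (hB z).trans (mul_le_mul_of_nonneg_left (pow_le_pow_left₀ (by positivity) ?_ _) hB0)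
          have := norm_le_norm_add_norm_sub' z x
          linarith
        · rw [mul_pow, pow_succ (1 + ‖x‖)]
          field_simp
    choose q hq hfq using hpart
    exact exists_pev_eq_of_fderiv hfd hq hfq

theorem newtonKernel_of_le {d : ℕ} {x : EuclideanSpace ℝ (Fin d)} (hx : 1 / 8 ≤ ‖x‖) :
    newtonKernel d x = ‖x‖ ^ ((2 : ℝ) - d) := by
  rw [newtonKernel, newtonProfile_of_le (by nlinarith), ← Real.rpow_natCast ‖x‖ 2,
    ← Real.rpow_mul (norm_nonneg x)]
  congr 1
  push_cast
  ring

theorem norm_fderiv_newtonKernel_le {d : ℕ} {x : EuclideanSpace ℝ (Fin d)} (hx : 1 / 8 < ‖x‖) :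
    ‖fderiv ℝ (newtonKernel d) x‖ ≤ |2 - (d : ℝ)| * ‖x‖ ^ ((1 : ℝ) - d) := by
  have hx0 : 0 < ‖x‖ := by linarith
  refine ContinuousLinearMap.opNorm_le_bound _ (by positivity) fun v => ?_
  have h : fderiv ℝ (newtonKernel d) x v = (2 - d) * ‖x‖ ^ (-(d : ℝ)) * inner ℝ x v := by
    have hpow : (‖x‖ ^ 2) ^ (-(d : ℝ) / 2) = ‖x‖ ^ (-(d : ℝ)) := by
      rw [← Real.rpow_natCast ‖x‖ 2, ← Real.rpow_mul hx0.le]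
      congr 1
      push_cast
      ring
    refine (fderiv_comp_norm_sq (differentiable_newtonProfile d) x v).trans ?_
    rw [deriv_newtonProfile_of_lt (by nlinarith), hpow]
    ring
  rw [h, norm_mul, norm_mul, Real.norm_eq_abs, Real.norm_of_nonneg (by positivity),
    sub_eq_add_neg (1 : ℝ), Real.rpow_add hx0, Real.rpow_one]
  calc |2 - (d : ℝ)| * ‖x‖ ^ (-(d : ℝ)) * ‖inner ℝ x v‖
      ≤ |2 - (d : ℝ)| * ‖x‖ ^ (-(d : ℝ)) * (‖x‖ * ‖v‖) := by
        gcongr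
        exact norm_inner_le_norm x v
    _ = |2 - (d : ℝ)| * (‖x‖ * ‖x‖ ^ (-(d : ℝ))) * ‖v‖ := by ring

/-- Pointwise decay of a kernel gives decay of the potentials of densities supported in
`‖y‖ ≤ 3 / 2`. -/
theorem norm_integral_smul_comp_sub_le {d : ℕ} {F : Type*} [NormedAddCommGroup F] [NormedSpace ℝ F]
    {f : EuclideanSpace ℝ (Fin d) → ℝ} (hf : Integrable f) (hsupp : ∀ y, 3 / 2 < ‖y‖ → f y = 0)
    {G : EuclideanSpace ℝ (Fin d) → F} {A s : ℝ} (hA : 0 ≤ A) (hs : s ≤ 0)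
    (hG : ∀ z, 1 / 8 < ‖z‖ → ‖G z‖ ≤ A * ‖z‖ ^ s) {x : EuclideanSpace ℝ (Fin d)} (hx : 2 ≤ ‖x‖) :
    ‖∫ y, f y • G (x - y)‖ ≤ (∫ y, |f y|) * (A * (1 / 4) ^ s) * ‖x‖ ^ s := by
  rw [mul_assoc, ← integral_mul_const]
  refine norm_integral_le_of_norm_le (hf.abs.mul_const _) (Eventually.of_forall fun y => ?_)
  rw [norm_smul, Real.norm_eq_abs]
  rcases le_or_gt ‖y‖ (3 / 2) with hy | hy
  · have hxy : 1 / 4 * ‖x‖ ≤ ‖x - y‖ := by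
      have := norm_sub_norm_le x y
      linarith
    refine mul_le_mul_of_nonneg_left ?_ (abs_nonneg _)
    rw [mul_assoc, ← Real.mul_rpow (by norm_num) (norm_nonneg x)]
    refine (hG _ (by linarith)).trans (mul_le_mul_of_nonneg_left ?_ hA)
    exact Real.rpow_le_rpow_of_nonpos (by linarith) hxy hs
  · simp [hsupp y hy]

theorem lapl_congr {d : ℕ} {f g : EuclideanSpace ℝ (Fin d) → ℝ} {x : EuclideanSpace ℝ (Fin d)}
    (h : f =ᶠ[nhds x] g) : lapl d f x = lapl d g x := by
  refine Finset.sum_congr rfl fun i _ => ?_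
  have : (fun y => fderiv ℝ f y (EuclideanSpace.single i 1)) =ᶠ[nhds x]
      fun y => fderiv ℝ g y (EuclideanSpace.single i 1) := by
    filter_upwards [h.fderiv (𝕜 := ℝ)] with y hy
    rw [hy]
  rw [this.fderiv_eq]

theorem lapl_sub {d : ℕ} {f g : EuclideanSpace ℝ (Fin d) → ℝ} (hf : ContDiff ℝ 2 f)
    (hg : ContDiff ℝ 2 g) (x : EuclideanSpace ℝ (Fin d)) :
    lapl d (fun y => f y - g y) x = lapl d f x - lapl d g x := by
  rw [lapl, lapl, lapl, ← Finset.sum_sub_distrib]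
  refine Finset.sum_congr rfl fun i _ => ?_
  have h : (fun y => fderiv ℝ (fun y => f y - g y) y (EuclideanSpace.single i 1)) = fun y =>
      fderiv ℝ f y (EuclideanSpace.single i 1) - fderiv ℝ g y (EuclideanSpace.single i 1) := by
    ext y
    rw [fderiv_fun_sub (hf.differentiable two_ne_zero y) (hg.differentiable two_ne_zero y)]
    rfl
  rw [h, fderiv_fun_sub ((contDiff_fderiv_apply_of_two hf _).differentiable one_ne_zero x)
    ((contDiff_fderiv_apply_of_two hg _).differentiable one_ne_zero x)]
  rfl

theorem lapl_const_mul {d : ℕ} {f : EuclideanSpace ℝ (Fin d) → ℝ} (hf : ContDiff ℝ 2 f) (a : ℝ)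
    (x : EuclideanSpace ℝ (Fin d)) : lapl d (fun y => a * f y) x = a * lapl d f x := by
  rw [lapl, lapl, Finset.mul_sum]
  refine Finset.sum_congr rfl fun i _ => ?_
  have h : (fun y => fderiv ℝ (fun y => a * f y) y (EuclideanSpace.single i 1)) = fun y =>
      a * fderiv ℝ f y (EuclideanSpace.single i 1) := by
    ext y
    rw [fderiv_const_mul (hf.differentiable two_ne_zero y)]
    rfl
  rw [h, fderiv_const_mul ((contDiff_fderiv_apply_of_two hf _).differentiable one_ne_zero x)]
  rfl

theorem continuous_lapl {d : ℕ} {f : EuclideanSpace ℝ (Fin d) → ℝ} (hf : ContDiff ℝ 2 f) :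
    Continuous (lapl d f) :=
  continuous_finsetSum _ fun _ _ =>
    ((contDiff_fderiv_apply_of_two hf _).continuous_fderiv one_ne_zero).clm_apply continuous_const

/-- A function which is harmonic outside the unit ball agrees up to a constant factor, for
`‖x‖ ≥ 3 / 2`, with a twice continuously differentiable function on the whole space. -/
theorem IsHarmonicOnSet.exists_contDiff_eq {d : ℕ} {u : EuclideanSpace ℝ (Fin d) → ℝ}
    (hu : IsHarmonicOnSet d u {x | 1 < ‖x‖}) :
    ∃ v : EuclideanSpace ℝ (Fin d) → ℝ, ContDiff ℝ 2 v ∧ (∀ x, 3 / 2 ≤ ‖x‖ → v x = u x) ∧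
      ∀ x, 3 / 2 < ‖x‖ → lapl d v x = 0 := by
  have hopen : IsOpen {x : EuclideanSpace ℝ (Fin d) | 1 < ‖x‖} :=
    isOpen_lt continuous_const continuous_norm
  have heq : ∀ x, 3 / 2 ≤ ‖x‖ → Real.smoothTransition (‖x‖ ^ 2 - 5 / 4) * u x = u x := by
    intro x hx
    rw [Real.smoothTransition.one_of_one_le (by nlinarith), one_mul]
  refine ⟨fun x => Real.smoothTransition (‖x‖ ^ 2 - 5 / 4) * u x, ?_, heq, fun x hx => ?_⟩
  · rw [contDiff_iff_contDiffAt]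
    intro x
    rcases lt_or_ge 1 ‖x‖ with hx | hx
    · exact (Real.smoothTransition.contDiff.comp
        ((contDiff_norm_sq ℝ).sub contDiff_const)).contDiffAt.mul
          (hu.1.contDiffAt (hopen.mem_nhds hx))
    · refine (contDiffAt_const (c := (0 : ℝ))).congr_of_eventuallyEq ?_
      have hlt : ‖x‖ ^ 2 < 5 / 4 := by nlinarith [norm_nonneg x]
      filter_upwards [(contDiff_norm_sq ℝ (n := 0)).continuous.continuousAt.eventually
        (gt_mem_nhds hlt)] with y hy
      rw [Real.smoothTransition.zero_of_nonpos (by linarith), zero_mul]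
  · rw [← hu.2 x (show 1 < ‖x‖ by linarith)]
    refine lapl_congr ?_
    filter_upwards [continuous_norm.continuousAt.eventually (lt_mem_nhds hx)] with y hy
    exact heq y hy.le

/-- Outside a ball, a harmonic function of polynomial growth is the sum of a polynomial and the
potential of a compactly supported density. -/
theorem IsHarmonicOnSet.exists_eq_pev_add_integral {d : ℕ} (hd : 3 ≤ d) {m : ℕ}
    {u : EuclideanSpace ℝ (Fin d) → ℝ} (hu : IsHarmonicOnSet d u {x | 1 < ‖x‖})
    {C : ℝ} (hC : ∀ x : EuclideanSpace ℝ (Fin d), 2 ≤ ‖x‖ → |u x| ≤ C * ‖x‖ ^ m) :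
    ∃ (p : MvPolynomial (Fin d) ℝ) (f : EuclideanSpace ℝ (Fin d) → ℝ), p.totalDegree ≤ m ∧
      Continuous f ∧ HasCompactSupport f ∧ (∀ y, 3 / 2 < ‖y‖ → f y = 0) ∧
      ∀ x, 13 / 8 < ‖x‖ → u x = pev p x + ∫ y, f y * newtonKernel d (x - y) := by
  obtain ⟨v₀, hv₀, hv₀u, hv₀l⟩ := hu.exists_contDiff_eq
  have hc := integral_radialBump_ne_zero hd
  set c := ∫ y, radialBump d y
  set v := fun x => c⁻¹ * v₀ x with hvdef
  have hv : ContDiff ℝ 2 v := contDiff_const.mul hv₀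
  have hvl : ∀ x, 3 / 2 < ‖x‖ → lapl d v x = 0 := fun x hx => by
    rw [hvdef, lapl_const_mul hv₀, hv₀l x hx, mul_zero]
  have hfc : HasCompactSupport (lapl d v) :=
    HasCompactSupport.of_support_subset_isCompact (isCompact_closedBall 0 (3 / 2)) fun x hx => by
      rw [mem_closedBall_zero_iff]
      exact not_lt.1 fun h => hx (hvl x h)
  have hf := continuous_lapl hv
  set w := fun x => ∫ y, lapl d v y * newtonKernel d (x - y) with hwdef
  set v' := fun x => ∫ y, radialBump d y * v (x - y) with hv'def
  have hηc := hasCompactSupport_radialBump d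
  have hη := (contDiff_radialBump d (k := 0)).continuous
  have hw : ContDiff ℝ 2 w :=
    contDiff_integral_mul_comp_sub hf hfc (k := 2) (contDiff_newtonKernel d (k := 2))
  have hv' : ContDiff ℝ 2 v' := contDiff_integral_mul_comp_sub hη hηc (k := 2) hv
  have hv'u : ∀ x, 13 / 8 < ‖x‖ → v' x = u x := by
    intro x hx
    have h := integral_radialBump_mul_comp_sub_smul hv (x := x) zero_le_one fun z hz => hvl z (by
      have := norm_le_norm_add_norm_sub z x
      linarith)
    simp_rw [one_smul] at h
    refine h.trans ?_
    rw [hvdef, ← hv₀u x (by linarith)]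
    exact mul_inv_cancel_left₀ hc _
  have hlap : ∀ x, lapl d (fun y => v' y - w y) x = 0 := by
    intro x
    rw [lapl_sub hv' hw, lapl_integral_mul_comp_sub hη hηc hv,
      lapl_integral_mul_comp_sub hf hfc (contDiff_newtonKernel d (k := 2)), lapl_newtonKernel,
      ← integral_sub_left_eq_self _ volume x, sub_eq_zero]
    simp_rw [sub_sub_cancel, mul_comm]
  have hd3 : (3 : ℝ) ≤ d := by exact_mod_cast hd
  obtain ⟨M, hM⟩ := (isCompact_closedBall (0 : EuclideanSpace ℝ (Fin d)) 2).exists_bound_of_continuousOn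
    (hv'.sub hw).continuous.continuousOn
  have hM0 : 0 ≤ M := (norm_nonneg _).trans (hM 0 (by simp))
  set K := (∫ y, |lapl d v y|) * (1 * (1 / 4) ^ ((2 : ℝ) - d))
  have hK : 0 ≤ K := by positivity
  have hgrowth : ∀ x, |v' x - w x| ≤ (M + |C| + K) * (1 + ‖x‖) ^ m := by
    intro x
    have h1 : 1 ≤ (1 + ‖x‖) ^ m := one_le_pow₀ (by linarith [norm_nonneg x])
    rcases le_or_gt ‖x‖ 2 with hx | hx
    · have := hM x (by simpa using hx)
      rw [Real.norm_eq_abs] at this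
      refine this.trans ?_
      nlinarith [abs_nonneg C]
    · have hwx : |w x| ≤ K * ‖x‖ ^ ((2 : ℝ) - d) :=
        norm_integral_smul_comp_sub_le (G := newtonKernel d)
          (hf.integrable_of_hasCompactSupport hfc) hvl zero_le_one (by linarith) (fun z hz => by
            rw [newtonKernel_of_le hz.le, Real.norm_of_nonneg (by positivity), one_mul]) hx.le
      have hx1 : ‖x‖ ^ ((2 : ℝ) - d) ≤ 1 :=
        Real.rpow_le_one_of_one_le_of_nonpos (by linarith) (by linarith)
      have hux : |v' x| ≤ |C| * (1 + ‖x‖) ^ m := by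
        rw [hv'u x (by linarith)]
        refine (hC x hx.le).trans ?_
        gcongr
        · exact le_abs_self C
        · linarith
      have := abs_sub (v' x) (w x)
      nlinarith
  obtain ⟨p, hp, hpe⟩ := exists_pev_eq_of_lapl_eq_zero hd m (hv'.sub hw) hlap hgrowth
  refine ⟨p, lapl d v, hp, hf, hfc, hvl, fun x hx => ?_⟩
  rw [← hpe, hv'u x hx]
  simp [hwdef]

theorem IsHarmonicOnSet.exists_pev_asymptotic {d : ℕ} (hd : 3 ≤ d) {m : ℕ}
    {u : EuclideanSpace ℝ (Fin d) → ℝ} (hu : IsHarmonicOnSet d u {x | 1 < ‖x‖})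
    {C : ℝ} (hC : ∀ x : EuclideanSpace ℝ (Fin d), 2 ≤ ‖x‖ → |u x| ≤ C * ‖x‖ ^ m) :
    ∃ (p : MvPolynomial (Fin d) ℝ) (K : ℝ), p.totalDegree ≤ m ∧
      (∀ x : EuclideanSpace ℝ (Fin d), 2 ≤ ‖x‖ →
        |u x - pev p x| ≤ K * ‖x‖ ^ ((2 : ℝ) - d)) ∧
      ∀ x : EuclideanSpace ℝ (Fin d), 2 ≤ ‖x‖ →
        ‖fderiv ℝ u x - fderiv ℝ (pev p) x‖ ≤ K * ‖x‖ ^ ((1 : ℝ) - d) := by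
  obtain ⟨p, f, hp, hf, hfc, hsupp, hup⟩ := hu.exists_eq_pev_add_integral hd hC
  have hd3 : (3 : ℝ) ≤ d := by exact_mod_cast hd
  have hfi := hf.integrable_of_hasCompactSupport hfc (μ := volume)
  refine ⟨p, max ((∫ y, |f y|) * (1 * (1 / 4) ^ ((2 : ℝ) - d)))
    ((∫ y, |f y|) * (|2 - (d : ℝ)| * (1 / 4) ^ ((1 : ℝ) - d))), hp, fun x hx => ?_, fun x hx => ?_⟩
  · rw [hup x (by linarith), add_sub_cancel_left]
    refine (norm_integral_smul_comp_sub_le (G := newtonKernel d) hfi hsupp zero_le_one (by linarith) (fun z hz => ?_)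
      hx).trans (mul_le_mul_of_nonneg_right (le_max_left _ _) (by positivity))
    rw [newtonKernel_of_le hz.le, Real.norm_of_nonneg (by positivity), one_mul]
  · have hu' : u =ᶠ[nhds x] fun y => pev p y + ∫ z, f z * newtonKernel d (y - z) := by
      have hx' : 13 / 8 < ‖x‖ := by linarith
      filter_upwards [continuous_norm.continuousAt.eventually (lt_mem_nhds hx')] with y hy
      exact hup y hy
    have hpd : DifferentiableAt ℝ (pev p) x := (contDiff_pev p).differentiable one_ne_zero x
    have hw := hasFDerivAt_integral_mul_comp_sub (μ := volume) hf hfc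
      (contDiff_newtonKernel d (k := 1)) x
    rw [hu'.fderiv_eq, (hpd.hasFDerivAt.fun_add hw).fderiv, add_sub_cancel_left]
    exact (norm_integral_smul_comp_sub_le hfi hsupp (abs_nonneg _) (by linarith)
      (fun z hz => norm_fderiv_newtonKernel_le hz) hx).trans
      (mul_le_mul_of_nonneg_right (le_max_right _ _) (by positivity))

theorem negCoordAt_apply {d : ℕ} (i : Fin d) (x : EuclideanSpace ℝ (Fin d)) (j : Fin d) :
    negCoordAt d i x j = (if j = i then -1 else 1) * x j := by
  rcases eq_or_ne j i with rfl | h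
  · simp [negCoordAt]
  · simp [negCoordAt, h]

/-- `negCoordAt d i` as a linear isometry. -/
def negCoordAtIsometry (d : ℕ) (i : Fin d) :
    EuclideanSpace ℝ (Fin d) →ₗᵢ[ℝ] EuclideanSpace ℝ (Fin d) where
  toFun := negCoordAt d i
  map_add' x y := by
    ext j
    simp only [negCoordAt_apply, PiLp.add_apply]
    ring
  map_smul' a x := by
    ext j
    simp only [negCoordAt_apply, PiLp.smul_apply, smul_eq_mul, RingHom.id_apply]
    ring
  norm_map' x := by
    simp only [LinearMap.coe_mk, AddHom.coe_mk, EuclideanSpace.norm_eq, negCoordAt_apply, norm_mul,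
      apply_ite norm, norm_neg, norm_one, ite_self, one_mul]

theorem norm_negCoordAt {d : ℕ} (i : Fin d) (x : EuclideanSpace ℝ (Fin d)) :
    ‖negCoordAt d i x‖ = ‖x‖ :=
  (negCoordAtIsometry d i).norm_map x

theorem negCoordAt_negCoordAt {d : ℕ} (i : Fin d) (x : EuclideanSpace ℝ (Fin d)) :
    negCoordAt d i (negCoordAt d i x) = x := by
  ext j
  rw [negCoordAt_apply, negCoordAt_apply]
  split_ifs <;> ring

theorem prod_negCoordAt_pow {d : ℕ} (i : Fin d) (x : EuclideanSpace ℝ (Fin d)) (α : Fin d →₀ ℕ) :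
    ∏ j, negCoordAt d i x j ^ α j = (-1) ^ α i * ∏ j, x j ^ α j := by
  simp_rw [negCoordAt_apply, mul_pow, Finset.prod_mul_distrib, ite_pow, one_pow]
  rw [Finset.prod_ite_eq' Finset.univ i fun j => (-1 : ℝ) ^ α j, if_pos (Finset.mem_univ i)]

/-- Symmetrization of a polynomial approximating a function which is even (`s = 1`) or odd
(`s = -1`) in the `i`-th coordinate. -/
theorem exists_pev_symm {d m : ℕ} {u : EuclideanSpace ℝ (Fin d) → ℝ}
    (hu : IsHarmonicOnSet d u {x | 1 < ‖x‖}) {p : MvPolynomial (Fin d) ℝ}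
    (hp : p.totalDegree ≤ m) {K a b : ℝ}
    (h0 : ∀ x : EuclideanSpace ℝ (Fin d), 2 ≤ ‖x‖ → |u x - pev p x| ≤ K * ‖x‖ ^ a)
    (h1 : ∀ x : EuclideanSpace ℝ (Fin d), 2 ≤ ‖x‖ →
      ‖fderiv ℝ u x - fderiv ℝ (pev p) x‖ ≤ K * ‖x‖ ^ b)
    (i : Fin d) {s : ℝ} (hs : |s| = 1)
    (hsymm : ∀ x : EuclideanSpace ℝ (Fin d), 1 < ‖x‖ → u (negCoordAt d i x) = s * u x) :
    ∃ q : MvPolynomial (Fin d) ℝ, q.totalDegree ≤ m ∧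
      (∀ x : EuclideanSpace ℝ (Fin d), 2 ≤ ‖x‖ → |u x - pev q x| ≤ K * ‖x‖ ^ a) ∧
      (∀ x : EuclideanSpace ℝ (Fin d), 2 ≤ ‖x‖ →
        ‖fderiv ℝ u x - fderiv ℝ (pev q) x‖ ≤ K * ‖x‖ ^ b) ∧
      ∀ x, pev q (negCoordAt d i x) = s * pev q x := by
  have hs2 : s * s = 1 := by rw [← abs_mul_abs_self, hs, one_mul]
  obtain ⟨q, hqm, hq⟩ : ∃ q : MvPolynomial (Fin d) ℝ, q.totalDegree ≤ m ∧
      ∀ x, pev q x = 2⁻¹ * (pev p x + s * pev p (negCoordAt d i x)) := by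
    refine ⟨reweight p fun α => (1 + s * (-1) ^ α i) / 2,
      (totalDegree_reweight_le p _).trans hp, fun x => ?_⟩
    rw [pev_reweight, pev_eq, pev_eq, Finset.mul_sum, ← Finset.sum_add_distrib, Finset.mul_sum]
    refine Finset.sum_congr rfl fun α _ => ?_
    rw [prod_negCoordAt_pow]
    ring
  have hσ : ∀ x, HasFDerivAt (negCoordAt d i) (negCoordAtIsometry d i).toContinuousLinearMap x :=
    fun x => (negCoordAtIsometry d i).toContinuousLinearMap.hasFDerivAt
  refine ⟨q, hqm, fun x hx => ?_, fun x hx => ?_, fun x => ?_⟩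
  · have hux : u x - pev q x =
        2⁻¹ * ((u x - pev p x) + s * (u (negCoordAt d i x) - pev p (negCoordAt d i x))) := by
      rw [hq, hsymm x (by linarith)]
      linear_combination -2⁻¹ * u x * hs2
    have hx' := h0 (negCoordAt d i x) (by rwa [norm_negCoordAt])
    rw [norm_negCoordAt] at hx'
    rw [hux, abs_mul, abs_of_pos (by norm_num : (0 : ℝ) < 2⁻¹)]
    have := abs_add_le (u x - pev p x) (s * (u (negCoordAt d i x) - pev p (negCoordAt d i x)))
    rw [abs_mul s, hs, one_mul] at this
    linarith [h0 x hx]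
  · have hopen : IsOpen {x : EuclideanSpace ℝ (Fin d) | 1 < ‖x‖} :=
      isOpen_lt continuous_const continuous_norm
    have hdiff : ∀ (r : MvPolynomial (Fin d) ℝ) (y : EuclideanSpace ℝ (Fin d)), 2 ≤ ‖y‖ →
        HasFDerivAt (fun z => u z - pev r z) (fderiv ℝ u y - fderiv ℝ (pev r) y) y := fun r y hy =>
      (((hu.1.contDiffAt (hopen.mem_nhds (show 1 < ‖y‖ by linarith))).differentiableAt
        two_ne_zero).hasFDerivAt).sub
        ((contDiff_pev r (k := 1)).differentiable one_ne_zero y).hasFDerivAt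
    have hx2 : 2 ≤ ‖negCoordAt d i x‖ := by rwa [norm_negCoordAt]
    have hux : (fun y => u y - pev q y) =ᶠ[nhds x]
        fun y => 2⁻¹ * ((u y - pev p y) + s * (u (negCoordAt d i y) - pev p (negCoordAt d i y))) := by
      filter_upwards [hopen.mem_nhds (show 1 < ‖x‖ by linarith)] with y hy
      rw [hq, hsymm y hy]
      linear_combination -2⁻¹ * u y * hs2
    have hD := (((hdiff p x hx).add (((hdiff p _ hx2).comp x (hσ x)).const_mul s)).const_mul
      2⁻¹).congr_of_eventuallyEq hux
    have hL := (hdiff q x hx).unique hD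
    have hx' := h1 _ hx2
    rw [norm_negCoordAt] at hx'
    rw [hL, norm_smul, Real.norm_of_nonneg (by norm_num : (0 : ℝ) ≤ 2⁻¹)]
    have := norm_add_le (fderiv ℝ u x - fderiv ℝ (pev p) x)
      (s • (fderiv ℝ u (negCoordAt d i x) - fderiv ℝ (pev p) (negCoordAt d i x)).comp
        (negCoordAtIsometry d i).toContinuousLinearMap)
    rw [norm_smul, Real.norm_eq_abs, hs, one_mul] at this
    have hcomp := ((fderiv ℝ u (negCoordAt d i x) -
      fderiv ℝ (pev p) (negCoordAt d i x)).opNorm_comp_le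
        (negCoordAtIsometry d i).toContinuousLinearMap).trans
      (mul_le_of_le_one_right (norm_nonneg _) (LinearIsometry.norm_toContinuousLinearMap_le _))
    linarith [h1 x hx]
  · rw [hq, hq, negCoordAt_negCoordAt]
    linear_combination -2⁻¹ * pev p (negCoordAt d i x) * hs2

theorem norm_gradient_sub_gradient {E : Type*} [NormedAddCommGroup E] [InnerProductSpace ℝ E]
    [CompleteSpace E] (f g : E → ℝ) (x : E) :
    ‖gradient f x - gradient g x‖ = ‖fderiv ℝ f x - fderiv ℝ g x‖ := by
  rw [gradient, gradient, ← map_sub, LinearIsometryEquiv.norm_map]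

/-- Liouville theorem in exterior domains, `n ≥ 3`. -/
theorem statement3 (n : ℕ) (hn : 3 ≤ n)
    (u : EuclideanSpace ℝ (Fin n) → ℝ) (m : ℕ)
    (hharm : IsHarmonicOnSet n u {x : EuclideanSpace ℝ (Fin n) | 1 < ‖x‖})
    (hgrowth : ∃ C : ℝ, ∀ x : EuclideanSpace ℝ (Fin n), 2 ≤ ‖x‖ → |u x| ≤ C * ‖x‖ ^ m) :
    (∃ (p : MvPolynomial (Fin n) ℝ) (C : ℝ), p.totalDegree ≤ m ∧
      (∀ x : EuclideanSpace ℝ (Fin n), 2 ≤ ‖x‖ →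
        |u x - pev p x| ≤ C * ‖x‖ ^ ((2 : ℝ) - (n : ℝ))) ∧
      (∀ x : EuclideanSpace ℝ (Fin n), 2 ≤ ‖x‖ →
        ‖gradient u x - gradient (pev p) x‖ ≤ C * ‖x‖ ^ ((1 : ℝ) - (n : ℝ)))) ∧
    ((∀ x : EuclideanSpace ℝ (Fin n), 1 < ‖x‖ →
        u (negCoordAt n ⟨0, by omega⟩ x) = -u x) →
      ∃ (p : MvPolynomial (Fin n) ℝ) (C : ℝ), p.totalDegree ≤ m ∧
        (∀ x : EuclideanSpace ℝ (Fin n), 2 ≤ ‖x‖ →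
          |u x - pev p x| ≤ C * ‖x‖ ^ ((2 : ℝ) - (n : ℝ))) ∧
        (∀ x : EuclideanSpace ℝ (Fin n), 2 ≤ ‖x‖ →
          ‖gradient u x - gradient (pev p) x‖ ≤ C * ‖x‖ ^ ((1 : ℝ) - (n : ℝ))) ∧
        (∀ x : EuclideanSpace ℝ (Fin n), pev p (negCoordAt n ⟨0, by omega⟩ x) = -pev p x)) ∧
    ((∀ x : EuclideanSpace ℝ (Fin n), 1 < ‖x‖ →
        u (negCoordAt n ⟨0, by omega⟩ x) = u x) →
      ∃ (p : MvPolynomial (Fin n) ℝ) (C : ℝ), p.totalDegree ≤ m ∧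
        (∀ x : EuclideanSpace ℝ (Fin n), 2 ≤ ‖x‖ →
          |u x - pev p x| ≤ C * ‖x‖ ^ ((2 : ℝ) - (n : ℝ))) ∧
        (∀ x : EuclideanSpace ℝ (Fin n), 2 ≤ ‖x‖ →
          ‖gradient u x - gradient (pev p) x‖ ≤ C * ‖x‖ ^ ((1 : ℝ) - (n : ℝ))) ∧
        (∀ x : EuclideanSpace ℝ (Fin n), pev p (negCoordAt n ⟨0, by omega⟩ x) = pev p x)) := by
  obtain ⟨C, hC⟩ := hgrowth
  obtain ⟨p, K, hp, h0, h1⟩ := hharm.exists_pev_asymptotic hn hC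
  simp_rw [norm_gradient_sub_gradient]
  refine ⟨⟨p, K, hp, h0, h1⟩, fun hodd => ?_, fun heven => ?_⟩
  · obtain ⟨q, hq, hq0, hq1, hqs⟩ := exists_pev_symm hharm hp h0 h1 ⟨0, by omega⟩ (s := -1)
      (by simp) fun x hx => by rw [hodd x hx, neg_one_mul]
    exact ⟨q, K, hq, hq0, hq1, fun x => by rw [hqs, neg_one_mul]⟩
  · obtain ⟨q, hq, hq0, hq1, hqs⟩ := exists_pev_symm hharm hp h0 h1 ⟨0, by omega⟩ (s := 1)
      (by simp) fun x hx => by rw [heven x hx, one_mul]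
    exact ⟨q, K, hq, hq0, hq1, fun x => by rw [hqs, one_mul]⟩

end
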